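/- (Well-posedness of the abstract mixed problem) Let V be a Hilbert space, Q a reflexive Banach space, a : V×V → ℝ bilinear continuous and coercive on Ker(B) (a(v,v) ≥ α‖v‖²_V for v ∈ Ker B), b : V×Q → ℝ bilinear continuous with associated operator B : V → Q' surjective (so ‖Bv‖_{Q'} ≥ β‖v‖_{V/Ker B} for some β > 0). Then for every f ∈ V', g ∈ Q' the mixed problem a(u,v) + b(v,p) = ⟨f,v⟩ for all v ∈ V, b(u,q) = ⟨g,q⟩ for all q ∈ Q, has a solution (u,p) ∈ V × Q with p unique modulo Ker(Bᵗ), and ‖u‖_V ≤ (1/α)‖f‖_{V'} + (1/β)(1 + ‖a‖/α)‖g‖_{Q'} and ‖p‖_{Q/Ker Bᵗ} ≤ (1/β)(1 + ‖a‖/α)(‖f‖_{V'} + (‖a‖/β)‖g‖_{Q'}). -/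

import Mathlib

/-- Every `g` in the range of a continuous linear map on a Hilbert space has a preimage whose
norm is controlled by the lower bound of the map modulo its kernel. -/
theorem exists_preimage_norm_le_of_lower_bound_mod_ker
    {V W : Type*} [NormedAddCommGroup V] [InnerProductSpace ℝ V] [CompleteSpace V]
    [NormedAddCommGroup W] [NormedSpace ℝ W] (b : V →L[ℝ] W)
    (hsurj : Function.Surjective fun v : V => b v) {β : ℝ} (hβ : 0 < β)
    (hlower : ∀ v : V,
      β * sInf {r : ℝ | ∃ v₀ : V, b v₀ = 0 ∧ r = ‖v + v₀‖} ≤ ‖b v‖) (g : W) :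
    ∃ v : V, b v = g ∧ β * ‖v‖ ≤ ‖g‖ := by
  obtain ⟨v, rfl⟩ := hsurj g
  let K : Submodule ℝ V := LinearMap.ker b.toLinearMap
  have hK : IsClosed (K : Set V) := b.isClosed_ker
  have : CompleteSpace K := hK.completeSpace_coe
  have hP : b (K.starProjection v) = 0 := K.starProjection_apply_mem v
  have hb : b (v - K.starProjection v) = b v := by simp [hP]
  refine ⟨v - K.starProjection v, hb, ?_⟩
  have hle : ‖v - K.starProjection v‖ ≤
      sInf {r : ℝ | ∃ v₀ : V, b v₀ = 0 ∧ r = ‖v - K.starProjection v + v₀‖} := by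
    refine le_csInf ⟨_, 0, map_zero b, rfl⟩ ?_
    rintro r ⟨v₀, hv₀, rfl⟩
    have horth : inner ℝ (v - K.starProjection v) v₀ = 0 :=
      K.starProjection_inner_eq_zero v v₀ hv₀
    have hpyth := norm_add_sq_eq_norm_sq_add_norm_sq_real horth
    nlinarith [norm_nonneg v₀, norm_nonneg (v - K.starProjection v),
      norm_nonneg (v - K.starProjection v + v₀)]
  calc β * ‖v - K.starProjection v‖ ≤ _ := mul_le_mul_of_nonneg_left hle hβ.le
    _ ≤ ‖b (v - K.starProjection v)‖ := hlower _
    _ = ‖b v‖ := by rw [hb]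

/-- Lax–Milgram on a complete subspace: existence together with the a priori estimate. -/
theorem exists_mem_forall_eq_of_coercive_on
    {V : Type*} [NormedAddCommGroup V] [InnerProductSpace ℝ V]
    (K : Submodule ℝ V) [CompleteSpace K] (a : V →L[ℝ] V →L[ℝ] ℝ) {α : ℝ} (hα : 0 < α)
    (hcoer : ∀ v ∈ K, α * ‖v‖ ^ 2 ≤ a v v) (f : V →L[ℝ] ℝ) :
    ∃ w ∈ K, (∀ v ∈ K, a w v = f v) ∧ α * ‖w‖ ≤ ‖f‖ := by
  let aK : K →L[ℝ] K →L[ℝ] ℝ := a.bilinearComp K.subtypeL K.subtypeL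
  have haK : IsCoercive aK := by
    refine ⟨α, hα, fun v => ?_⟩
    have h := hcoer v v.2
    rw [pow_two, ← mul_assoc] at h
    exact h
  let e := haK.continuousLinearEquivOfBilin
  let y : K := (InnerProductSpace.toDual ℝ K).symm (f.comp K.subtypeL)
  have hw : ∀ v : K, a (e.symm y : K) v = f v := by
    intro v
    have h1 := haK.continuousLinearEquivOfBilin_apply (e.symm y) v
    have h2 : inner ℝ y v = f v := InnerProductSpace.toDual_symm_apply
    rw [show haK.continuousLinearEquivOfBilin (e.symm y) = y from e.apply_symm_apply y, h2] at h1
    exact h1.symm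
  refine ⟨(e.symm y : K), (e.symm y).2, fun v hv => hw ⟨v, hv⟩, ?_⟩
  set w : V := ((e.symm y : K) : V)
  have h1 : α * ‖w‖ ^ 2 ≤ ‖f‖ * ‖w‖ :=
    (hcoer w (e.symm y).2).trans <| by
      rw [hw (e.symm y)]
      exact (le_abs_self _).trans (f.le_opNorm w)
  rcases (norm_nonneg w).eq_or_lt with h0 | h0
  · simp [← h0]
  · refine le_of_mul_le_mul_right ?_ h0
    linarith

/-- A functional vanishing on the kernel of `b : V → Q'` is of the form `v ↦ b v p`, if `Q` is
reflexive and `b` admits norm-controlled preimages. -/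
theorem exists_forall_apply_eq_of_vanish_on_ker
    {V Q : Type*} [NormedAddCommGroup V] [NormedSpace ℝ V]
    [NormedAddCommGroup Q] [NormedSpace ℝ Q]
    (hrefl : Function.Surjective (NormedSpace.inclusionInDoubleDual ℝ Q))
    (b : V →L[ℝ] Q →L[ℝ] ℝ) {β : ℝ} (hβ : 0 < β)
    (hlift : ∀ g : Q →L[ℝ] ℝ, ∃ v : V, b v = g ∧ β * ‖v‖ ≤ ‖g‖)
    (L : V →L[ℝ] ℝ) (hL : ∀ v, b v = 0 → L v = 0) :
    ∃ p : Q, (∀ v, b v p = L v) ∧ β * ‖p‖ ≤ ‖L‖ := by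
  choose s hs hsn using hlift
  have hLs : ∀ v, L (s (b v)) = L v := by
    intro v
    rw [← sub_eq_zero, ← map_sub]
    exact hL _ (by rw [map_sub, hs, sub_self])
  let φ : StrongDual ℝ (StrongDual ℝ Q) := LinearMap.mkContinuous
    { toFun := fun g => L (s g)
      map_add' := fun g h => by
        rw [← map_add, ← hLs (s g + s h), map_add b, hs, hs]
      map_smul' := fun c g => by
        rw [RingHom.id_apply, ← map_smul, ← hLs (c • s g), map_smul b, hs] }
    (‖L‖ / β) (fun g => by
      have h := mul_le_mul_of_nonneg_left (hsn g) (norm_nonneg L)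
      refine (L.le_opNorm (s g)).trans ?_
      rw [div_mul_eq_mul_div, le_div_iff₀ hβ]
      linarith)
  obtain ⟨p, hp⟩ := hrefl φ
  have hφ : ∀ g : StrongDual ℝ Q, g p = L (s g) := fun g => by
    rw [← NormedSpace.dual_def ℝ Q p g, hp]
    rfl
  refine ⟨p, fun v => (hφ (b v)).trans (hLs v), ?_⟩
  have hn : ‖p‖ ≤ ‖L‖ / β := by
    rw [← (NormedSpace.inclusionInDoubleDualLi ℝ (E := Q)).norm_map p]
    change ‖NormedSpace.inclusionInDoubleDual ℝ Q p‖ ≤ _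
    rw [hp]
    exact LinearMap.mkContinuous_norm_le _ (by positivity) _
  rw [le_div_iff₀ hβ] at hn
  linarith


/-- Well-posedness of the abstract mixed (saddle point) problem.
`V` is a Hilbert space, `Q` a reflexive Banach space, `a` a continuous bilinear form on
`V` coercive on `Ker B`, and `b` a continuous bilinear form on `V × Q` whose associated
operator `B = v ↦ b v : V → Q'` is surjective, with the inf-sup constant `β`.
Then for every `f ∈ V'`, `g ∈ Q'` the mixed problem has a solution `(u, p)` which is
unique with `p` unique modulo `Ker Bᵗ`, together with the a priori estimates. -/
theorem mixed_problem_wellposed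
    {V Q : Type*} [NormedAddCommGroup V] [InnerProductSpace ℝ V] [CompleteSpace V]
    [NormedAddCommGroup Q] [NormedSpace ℝ Q] [CompleteSpace Q]
    (hrefl : Function.Surjective (NormedSpace.inclusionInDoubleDual ℝ Q))
    (a : V →L[ℝ] V →L[ℝ] ℝ) (b : V →L[ℝ] Q →L[ℝ] ℝ)
    (α : ℝ) (hα : 0 < α)
    (hcoer : ∀ v : V, b v = 0 → α * ‖v‖ ^ 2 ≤ a v v)
    (hsurj : Function.Surjective fun v : V => b v)
    (β : ℝ) (hβ : 0 < β)
    (hinfsup : ∀ v : V,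
      β * sInf {r : ℝ | ∃ v₀ : V, b v₀ = 0 ∧ r = ‖v + v₀‖} ≤ ‖b v‖) :
    ∀ (f : V →L[ℝ] ℝ) (g : Q →L[ℝ] ℝ),
      ∃ (u : V) (p : Q),
        (∀ v : V, a u v + b v p = f v) ∧
        (∀ q : Q, b u q = g q) ∧
        (∀ (u' : V) (p' : Q),
            (∀ v : V, a u' v + b v p' = f v) → (∀ q : Q, b u' q = g q) →
            u' = u ∧ b.flip p' = b.flip p) ∧
        ‖u‖ ≤ (1 / α) * ‖f‖ + (1 / β) * (1 + ‖a‖ / α) * ‖g‖ ∧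
        sInf {r : ℝ | ∃ p₀ : Q, b.flip p₀ = 0 ∧ r = ‖p + p₀‖} ≤
          (1 / β) * (1 + ‖a‖ / α) * (‖f‖ + (‖a‖ / β) * ‖g‖) := by
  intro f g
  have hlift := exists_preimage_norm_le_of_lower_bound_mod_ker b hsurj hβ hinfsup
  obtain ⟨z, hz, hzn⟩ := hlift g
  let K : Submodule ℝ V := LinearMap.ker b.toLinearMap
  have hK : IsClosed (K : Set V) := b.isClosed_ker
  have : CompleteSpace K := hK.completeSpace_coe
  obtain ⟨w, hwK, hw, hwn⟩ := exists_mem_forall_eq_of_coercive_on K a hα hcoer (f - a z)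
  replace hwK : b w = 0 := hwK
  have hLker : ∀ v, b v = 0 → (f - a (w + z)) v = 0 := by
    intro v hv
    have h := hw v hv
    simp only [sub_apply, map_add, add_apply] at h ⊢
    linarith
  obtain ⟨p, hp, hpn⟩ :=
    exists_forall_apply_eq_of_vanish_on_ker hrefl b hβ hlift (f - a (w + z)) hLker
  have hz' : ‖z‖ ≤ ‖g‖ / β := by rw [le_div_iff₀ hβ]; linarith
  have hw' : ‖w‖ ≤ (‖f‖ + ‖a‖ * (‖g‖ / β)) / α := by
    rw [le_div_iff₀ hα, mul_comm]
    calc α * ‖w‖ ≤ ‖f - a z‖ := hwn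
      _ ≤ ‖f‖ + ‖a z‖ := norm_sub_le _ _
      _ ≤ ‖f‖ + ‖a‖ * ‖z‖ := by gcongr; exact a.le_opNorm z
      _ ≤ _ := by gcongr
  have hu : ‖w + z‖ ≤ (1 / α) * ‖f‖ + (1 / β) * (1 + ‖a‖ / α) * ‖g‖ := by
    calc ‖w + z‖ ≤ ‖w‖ + ‖z‖ := norm_add_le _ _
      _ ≤ (‖f‖ + ‖a‖ * (‖g‖ / β)) / α + ‖g‖ / β := add_le_add hw' hz'
      _ = _ := by ring
  refine ⟨w + z, p, fun v => ?_, fun q => ?_, fun u' p' h1 h2 => ?_, hu, ?_⟩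
  · rw [hp v, sub_apply, add_sub_cancel]
  · rw [map_add, hwK, hz, zero_add]
  · have hker : b (u' - (w + z)) = 0 := by
      ext q
      simp [h2 q, hwK, hz]
    have ha : ∀ v, a (u' - (w + z)) v + (b v p' - b v p) = 0 := by
      intro v
      have e1 := h1 v
      have e2 := hp v
      rw [sub_apply] at e2
      rw [map_sub, sub_apply]
      linarith
    have hz0 : a (u' - (w + z)) (u' - (w + z)) = 0 := by
      have h := ha (u' - (w + z))
      rw [hker] at h
      simpa using h
    have h0 : u' - (w + z) = 0 := by
      have h := hcoer _ hker
      rw [hz0] at h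
      have hsq : ‖u' - (w + z)‖ ^ 2 ≤ 0 := by
        by_contra! hpos
        exact absurd h (not_le.2 (mul_pos hα hpos))
      exact norm_eq_zero.1 (pow_eq_zero_iff two_ne_zero |>.1 (le_antisymm hsq (sq_nonneg _)))
    refine ⟨sub_eq_zero.1 h0, ?_⟩
    ext v
    have h := ha v
    rw [h0, map_zero, zero_apply, zero_add] at h
    exact sub_eq_zero.1 h
  · have hinf : sInf {r : ℝ | ∃ p₀ : Q, b.flip p₀ = 0 ∧ r = ‖p + p₀‖} ≤ ‖p‖ :=
      csInf_le ⟨0, by rintro r ⟨p₀, -, rfl⟩; exact norm_nonneg _⟩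
        ⟨0, map_zero _, by rw [add_zero]⟩
    refine hinf.trans ?_
    have hL : ‖f - a (w + z)‖ ≤
        ‖f‖ + ‖a‖ * ((1 / α) * ‖f‖ + (1 / β) * (1 + ‖a‖ / α) * ‖g‖) :=
      calc ‖f - a (w + z)‖ ≤ ‖f‖ + ‖a (w + z)‖ := norm_sub_le _ _
        _ ≤ ‖f‖ + ‖a‖ * ‖w + z‖ := by gcongr; exact a.le_opNorm _
        _ ≤ _ := by gcongr
    calc ‖p‖ ≤ (‖f‖ + ‖a‖ * ((1 / α) * ‖f‖ + (1 / β) * (1 + ‖a‖ / α) * ‖g‖)) / β := by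
          rw [le_div_iff₀ hβ]; linarith
      _ = _ := by ring
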